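/- Let 𝒯_0 be a colored initial triangulation. For any d-simplex T ∈ 𝕄, any vertex v ∈ 𝒱(T), and all edges e, e' ∈ ℰ(T) with v ∈ e ∩ e', one has |gen#(e) − gen#(e')| ≤ d − 1. -/

import Mathlib

noncomputable section

namespace BisecGrading

/-- Points of `ℝ^d`. -/
abbrev Pt (d : ℕ) : Type := Fin d → ℝ

/-- Integer ceiling `⌈g / d⌉` (for `d > 0`). -/
def lvlZ (d : ℕ) (g : ℤ) : ℤ := (g + d - 1) / d

/-- The type `g - d * (⌈g/d⌉ - 1)` of a generation `g`. -/
def typZ (d : ℕ) (g : ℤ) : ℤ := g - d * (lvlZ d g - 1)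

/-- A `d`-simplex, given by its ordered vertex list (in Maubach's ordering) together
with its generation counter. -/
structure Simplex (d : ℕ) where
  vertex : Fin (d + 1) → Pt d
  gen : ℕ

namespace Simplex

variable {d : ℕ}

instance : DecidableEq (Simplex d) := Classical.decEq _

/-- Maubach's index `k = d - (gen T % d)`. -/
def k (T : Simplex d) : ℕ := d - T.gen % d

lemma k_le (T : Simplex d) : T.k ≤ d := Nat.sub_le _ _

/-- `k` as an index into the vertex list. -/
def kIdx (T : Simplex d) : Fin (d + 1) := ⟨T.k, Nat.lt_succ_of_le T.k_le⟩

/-- The bisection vertex `(v₀ + v_k)/2`. -/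
def bsv (T : Simplex d) : Pt d := midpoint ℝ (T.vertex 0) (T.vertex T.kIdx)

/-- The bisection edge `[v₀, v_k]`, as an unordered pair of points. -/
def bse (T : Simplex d) : Sym2 (Pt d) := s(T.vertex 0, T.vertex T.kIdx)

/-- The first child `[v₀, …, v_{k-1}, v', v_{k+1}, …, v_d]` of Maubach's bisection. -/
def child1 (T : Simplex d) : Simplex d where
  vertex := Function.update T.vertex T.kIdx T.bsv
  gen := T.gen + 1

/-- The second child `[v₁, …, v_k, v', v_{k+1}, …, v_d]` of Maubach's bisection. -/
def child2 (T : Simplex d) : Simplex d where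
  vertex := fun i =>
    if h : (i : ℕ) < T.k then
      T.vertex ⟨(i : ℕ) + 1, by have hk := T.k_le; omega⟩
    else if (i : ℕ) = T.k then T.bsv
    else T.vertex i
  gen := T.gen + 1

/-- `T'` is a child of `T`. -/
def IsChild (T' T : Simplex d) : Prop := T' = T.child1 ∨ T' = T.child2

/-- The vertex set `𝒱(T)`. -/
def V (T : Simplex d) : Set (Pt d) := Set.range T.vertex

/-- The edge set `ℰ(T)`. -/
def E (T : Simplex d) : Set (Sym2 (Pt d)) :=
  {e | ∃ i j : Fin (d + 1), i ≠ j ∧ e = s(T.vertex i, T.vertex j)}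

/-- The closed simplex (convex hull of the vertices). -/
def hull (T : Simplex d) : Set (Pt d) := convexHull ℝ (Set.range T.vertex)

/-- The level `⌈gen/d⌉` of a `d`-simplex. -/
def lvl (T : Simplex d) : ℤ := lvlZ d T.gen

/-- The type of a `d`-simplex. -/
def typ (T : Simplex d) : ℤ := typZ d T.gen

end Simplex

variable {d : ℕ}

/-- Membership in the master tree generated from the initial triangulation `T0`. -/
inductive MemM (T0 : Finset (Simplex d)) : Simplex d → Prop
  | init {T : Simplex d} : T ∈ T0 → MemM T0 T
  | child {T T' : Simplex d} : MemM T0 T → T'.IsChild T → MemM T0 T'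

/-- `Refines 𝒯₁ 𝒯₂` : the partition `𝒯₂` is obtained from `𝒯₁` by finitely many
single bisections. -/
inductive Refines : Finset (Simplex d) → Finset (Simplex d) → Prop
  | refl (𝒯 : Finset (Simplex d)) : Refines 𝒯 𝒯
  | step {𝒯₁ 𝒯₂ : Finset (Simplex d)} (T : Simplex d) :
      Refines 𝒯₁ 𝒯₂ → T ∈ 𝒯₂ →
      Refines 𝒯₁ (insert T.child1 (insert T.child2 (𝒯₂.erase T)))

/-- The subsimplex of `T` spanned by the vertex positions in `s`. -/
def faceSet (T : Simplex d) (s : Finset (Fin (d + 1))) : Set (Pt d) :=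
  convexHull ℝ (T.vertex '' ↑s)

/-- Conformity: any two simplices meet in the empty set or in a common subsimplex. -/
def Conforming (𝒯 : Finset (Simplex d)) : Prop :=
  ∀ T₁ ∈ 𝒯, ∀ T₂ ∈ 𝒯,
    T₁.hull ∩ T₂.hull = ∅ ∨
      ∃ s₁ s₂ : Finset (Fin (d + 1)), s₁.Nonempty ∧ s₂.Nonempty ∧
        T₁.hull ∩ T₂.hull = faceSet T₁ s₁ ∧ T₁.hull ∩ T₂.hull = faceSet T₂ s₂

/-- The conforming triangulations obtained from `T0` by successive bisections. -/
def Bisec (T0 : Finset (Simplex d)) : Set (Finset (Simplex d)) :=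
  {𝒯 | Refines T0 𝒯 ∧ Conforming 𝒯}

/-- All vertices of a triangulation. -/
def verticesOf (𝒯 : Finset (Simplex d)) : Set (Pt d) := ⋃ T ∈ 𝒯, T.V

/-- All edges of a triangulation. -/
def edgesOf (𝒯 : Finset (Simplex d)) : Set (Sym2 (Pt d)) := ⋃ T ∈ 𝒯, T.E

/-- Midpoint of an edge; this is the bisection vertex of the edge. -/
def edgeMid (e : Sym2 (Pt d)) : Pt d :=
  Sym2.lift ⟨fun a b => midpoint ℝ a b, fun a b => midpoint_comm a b⟩ e

/-- The closed segment covered by an edge. -/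
def edgeSeg (e : Sym2 (Pt d)) : Set (Pt d) :=
  Sym2.lift ⟨fun a b => segment ℝ a b, fun a b => segment_symm ℝ a b⟩ e

/-- A colored conforming initial triangulation (with the vertices of each initial
simplex ordered so that the colors read `(d, 0, 1, …, d-1)`), together with the
induced generation function on all vertices of the master tree. -/
structure ColoredSetup (d : ℕ) where
  T0 : Finset (Simplex d)
  indep : ∀ T ∈ T0, AffineIndependent ℝ T.vertex
  gen_zero : ∀ T ∈ T0, T.gen = 0
  conf : Conforming T0
  disjInt : ∀ T₁ ∈ T0, ∀ T₂ ∈ T0, T₁ ≠ T₂ → interior T₁.hull ∩ interior T₂.hull = ∅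
  color : Pt d → ℕ
  color_zero : ∀ T ∈ T0, color (T.vertex 0) = d
  color_succ : ∀ T ∈ T0, ∀ i : Fin (d + 1), (i : ℕ) ≠ 0 → color (T.vertex i) = (i : ℕ) - 1
  vgen : Pt d → ℤ
  vgen_init : ∀ T ∈ T0, ∀ i : Fin (d + 1), vgen (T.vertex i) = -(color (T.vertex i) : ℤ)
  vgen_bsv : ∀ T : Simplex d, MemM T0 T → vgen T.bsv = (T.gen : ℤ) + 1

namespace ColoredSetup

variable {d : ℕ} (S : ColoredSetup d)

/-- Level of a vertex. -/
def lvlV (v : Pt d) : ℤ := lvlZ d (S.vgen v)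

/-- Type of a vertex. -/
def typV (v : Pt d) : ℤ := typZ d (S.vgen v)

/-- Generation of an edge: the maximal generation of its endpoints. -/
def genE (e : Sym2 (Pt d)) : ℤ :=
  Sym2.lift ⟨fun a b => max (S.vgen a) (S.vgen b), fun a b => max_comm _ _⟩ e

/-- Level of an edge. -/
def lvlE (e : Sym2 (Pt d)) : ℤ := lvlZ d (S.genE e)

/-- Type of an edge. -/
def typE (e : Sym2 (Pt d)) : ℤ := typZ d (S.genE e)

/-- `gen#` of an edge: the generation of its bisection vertex (= its midpoint). -/
def genSharpE (e : Sym2 (Pt d)) : ℤ := S.vgen (edgeMid e)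

/-- `level#` of an edge. -/
def lvlSharpE (e : Sym2 (Pt d)) : ℤ := lvlZ d (S.genSharpE e)

/-- `type#` of an edge. -/
def typSharpE (e : Sym2 (Pt d)) : ℤ := typZ d (S.genSharpE e)

end ColoredSetup

/-- Chains of pairwise intersecting simplices of length `N`. -/
def IsSimChain (𝒮 : Set (Simplex d)) (T T' : Simplex d) (N : ℕ) : Prop :=
  ∃ f : Fin (N + 1) → Simplex d, (∀ i, f i ∈ 𝒮) ∧ f 0 = T ∧ f (Fin.last N) = T' ∧
    ∀ i : Fin N, ((f i.castSucc).hull ∩ (f i.succ).hull).Nonempty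

/-- The simplex distance `δ_𝒯`. -/
def simDist (𝒯 : Finset (Simplex d)) (T T' : Simplex d) : ℕ :=
  sInf {N | IsSimChain (↑𝒯) T T' N}

/-- Chains of `1`-neighbours (consecutive simplices share an edge). -/
def Is1Chain (𝒮 : Set (Simplex d)) (T T' : Simplex d) (N : ℕ) : Prop :=
  ∃ f : Fin (N + 1) → Simplex d, (∀ i, f i ∈ 𝒮) ∧ f 0 = T ∧ f (Fin.last N) = T' ∧
    ∀ i : Fin N, ((f i.castSucc).E ∩ (f i.succ).E).Nonempty

/-- The `1`-distance `δ¹_𝒮`. -/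
def dist1 (𝒮 : Set (Simplex d)) (T T' : Simplex d) : ℕ :=
  sInf {N | Is1Chain 𝒮 T T' N}

/-- The uniform patch `ω_{𝒯₀⁺}(v)` in the full uniform refinement `𝒯₀⁺`. -/
def patchPlus (S : ColoredSetup d) (v : Pt d) : Set (Simplex d) :=
  {T | MemM S.T0 T ∧ T.gen = d ∧ v ∈ T.V}

/-- The constant `C(𝒯₀)`. -/
def Cconst (S : ColoredSetup d) : ℕ :=
  sSup {n | ∃ v ∈ verticesOf S.T0, ∃ T ∈ patchPlus S v, ∃ T' ∈ patchPlus S v,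
    n = dist1 (patchPlus S v) T T'}

/-- `v` lies in some `n`-subsimplex of an initial simplex. -/
def InMacroSub (S : ColoredSetup d) (n : ℕ) (v : Pt d) : Prop :=
  ∃ T ∈ S.T0, ∃ s : Finset (Fin (d + 1)), s.card = n + 1 ∧ v ∈ convexHull ℝ (T.vertex '' ↑s)

/-- `v` is an `n`-macro vertex. -/
def IsMacro (S : ColoredSetup d) (n : ℕ) (v : Pt d) : Prop :=
  InMacroSub S n v ∧ ∀ m : ℕ, m < n → ¬ InMacroSub S m v

/-- The maximal level jump at a vertex `v`. -/
def jump (S : ColoredSetup d) (v : Pt d) : ℕ :=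
  sSup {n | ∃ 𝒯 ∈ Bisec S.T0, ∃ e ∈ edgesOf 𝒯, ∃ e' ∈ edgesOf 𝒯,
    v ∈ e ∧ v ∈ e' ∧ (n : ℤ) = |S.lvlE e - S.lvlE e'|}

/-- The constants `J_n`. -/
def J (S : ColoredSetup d) (n : ℕ) : ℤ :=
  if n = 0 then ⌈((Cconst S : ℚ) + 1) * (1 - 1 / (d : ℚ))⌉ - 2
  else if n ≤ d - 2 then 2 else 0

/-- The constant `Γ = 1 + Σ_{n=0}^{d-2} J_n`. -/
def Gam (S : ColoredSetup d) : ℤ := 1 + ∑ n ∈ Finset.range (d - 1), J S n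

/-- The edges spanned by a set of points. -/
def edgeOfSet (A : Set (Pt d)) : Set (Sym2 (Pt d)) :=
  {e | ∃ a ∈ A, ∃ b ∈ A, a ≠ b ∧ e = s(a, b)}

/-- `FirstBisected A T e` : along descendants of `T` that keep all points of `A` as
vertices, `e` is the first edge spanned by points of `A` which occurs as a bisection
edge, i.e. the edge of the subsimplex spanned by `A` that is bisected first. -/
inductive FirstBisected (A : Set (Pt d)) : Simplex d → Sym2 (Pt d) → Prop
  | found {T : Simplex d} : T.bse ∈ edgeOfSet A → FirstBisected A T T.bse
  | step {T T' : Simplex d} {e : Sym2 (Pt d)} :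
      T.bse ∉ edgeOfSet A → T'.IsChild T → A ⊆ T'.V →
      FirstBisected A T' e → FirstBisected A T e

/-- The uniform vertex patch `ω_m(v)`. -/
def patchU (S : ColoredSetup d) (m : ℕ) (v : Pt d) : Set (Simplex d) :=
  {T | MemM S.T0 T ∧ T.gen = m * d ∧ v ∈ T.V}

/-- The patch boundary `∂ω_m(v)`: union of the `(d-1)`-subsimplices of members of
`ω_m(v)` not containing `v`. -/
def patchBd (S : ColoredSetup d) (m : ℕ) (v : Pt d) : Set (Pt d) :=
  ⋃ T ∈ patchU S m v,
    ⋃ s ∈ {s : Finset (Fin (d + 1)) | s.card = d ∧ v ∉ convexHull ℝ (T.vertex '' ↑s)},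
      convexHull ℝ (T.vertex '' ↑s)

/-- The neighbourhood `Ω_m(v)`. -/
def nbhd (S : ColoredSetup d) (m : ℕ) (v : Pt d) : Set (Pt d) :=
  (⋃ T ∈ patchU S m v, T.hull) \ patchBd S m v

/-- The Kuhn simplex `T_π = [0, e_{π(1)}, e_{π(1)}+e_{π(2)}, …]`, of generation `0`. -/
def kuhnSimplex (d : ℕ) (π : Equiv.Perm (Fin d)) : Simplex d where
  vertex := fun i x => if ((π.symm x : ℕ)) < (i : ℕ) then 1 else 0
  gen := 0

/-- The average diameter `h₀` of the initial triangulation. -/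
def avgDiam (T0 : Finset (Simplex d)) : ℝ :=
  (∑ T ∈ T0, Metric.diam T.hull) / T0.card

/-- The regularized mesh size function `h_𝒯`. -/
def regMesh (T0 𝒯 : Finset (Simplex d)) (T : Simplex d) : ℝ :=
  avgDiam T0 * sInf {x : ℝ | ∃ T' ∈ 𝒯, x = (2 : ℝ) ^ (-(T'.lvl) + (simDist 𝒯 T T' : ℤ))}

namespace Simplex

lemma k_pos (hd : 0 < d) (T : Simplex d) : 1 ≤ T.k := by
  have := Nat.mod_lt T.gen hd
  unfold k
  omega

/-- As long as the refinement cycle of length `d` is not completed, bisection lowers `k` by one. -/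
lemma k_of_gen_succ {T T' : Simplex d} (hg : T'.gen = T.gen + 1) (hk : 2 ≤ T.k) :
    T'.k = T.k - 1 := by
  unfold k at *
  rw [hg]
  have h : (T.gen + 1) % d = T.gen % d + 1 := by
    rw [Nat.add_mod, Nat.mod_eq_of_lt (a := 1) (by omega), Nat.mod_eq_of_lt (by omega)]
  omega

/-- When the refinement cycle of length `d` is completed, `k` is reset to `d`. -/
lemma k_of_gen_succ_of_k_eq_one (hd : 0 < d) {T T' : Simplex d} (hg : T'.gen = T.gen + 1)
    (hk : T.k = 1) : T'.k = d := by
  unfold k at *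
  rw [hg]
  have h : (T.gen + 1) % d = 0 := by
    have h1 : T.gen % d + 1 = d := by have := Nat.mod_lt T.gen hd; omega
    rw [← Nat.mod_add_mod, h1, Nat.mod_self]
  omega

lemma child1_vertex {T : Simplex d} {i : Fin (d + 1)} (hi : (i : ℕ) ≠ T.k) :
    T.child1.vertex i = T.vertex i :=
  Function.update_of_ne (fun h => hi (congrArg Fin.val h)) _ _

lemma child2_vertex_of_gt {T : Simplex d} {i : Fin (d + 1)} (hi : T.k < (i : ℕ)) :
    T.child2.vertex i = T.vertex i := by
  simp [child2, not_lt_of_gt hi, hi.ne']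

lemma child2_vertex_pred {T : Simplex d} {i : Fin (d + 1)} (h0 : 0 < (i : ℕ))
    (hi : (i : ℕ) ≤ T.k) :
    T.child2.vertex ⟨(i : ℕ) - 1, by omega⟩ = T.vertex i := by
  have h : (i : ℕ) - 1 < T.k := by omega
  simp only [child2, h, dif_pos]
  congr 1
  ext
  simp only
  omega

end Simplex

/-- Moving one vertex of an affinely independent family to the midpoint of an edge at this vertex
preserves affine independence. -/
lemma affineIndependent_update_midpoint {ι E : Type*} [Fintype ι] [DecidableEq ι]
    [AddCommGroup E] [Module ℝ E] {p : ι → E} (hp : AffineIndependent ℝ p) {i j : ι}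
    (hij : i ≠ j) : AffineIndependent ℝ (Function.update p i (midpoint ℝ (p i) (p j))) := by
  rw [affineIndependent_iff_of_fintype] at hp ⊢
  intro w hw hwp
  rw [Finset.univ.weightedVSub_eq_linear_combination hw] at hwp
  set u : ι → ℝ := fun l => w l + (w i / 2) * ((if l = j then 1 else 0) - if l = i then 1 else 0)
    with hu
  have hu0 : ∑ l, u l = 0 := by
    simp [hu, Finset.sum_add_distrib, ← Finset.mul_sum, hw]
  have hup : ∑ l, u l • p l = 0 := by
    rw [← hwp, ← Finset.add_sum_erase _ _ (Finset.mem_univ i),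
      ← Finset.add_sum_erase _ (fun l => w l • Function.update p i _ l) (Finset.mem_univ i)]
    have hj : j ∈ Finset.univ.erase i := by simp [hij.symm]
    rw [← Finset.add_sum_erase _ _ hj, ← Finset.add_sum_erase _ (fun l => w l • _) hj]
    have hrest : ∑ l ∈ (Finset.univ.erase i).erase j, u l • p l =
        ∑ l ∈ (Finset.univ.erase i).erase j,
          w l • Function.update p i (midpoint ℝ (p i) (p j)) l := by
      refine Finset.sum_congr rfl fun l hl => ?_
      simp only [Finset.mem_erase, Finset.mem_univ, and_true] at hl
      simp [hu, hl.1, hl.2]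
    rw [hrest]
    simp only [hu, Function.update_self, Function.update_of_ne hij.symm, midpoint_eq_smul_add,
      hij, hij.symm, if_true, if_false, invOf_eq_inv]
    module
  have hu_all := hp u hu0 (by rw [Finset.univ.weightedVSub_eq_linear_combination hu0, hup])
  have hi : w i = 0 := by
    have := hu_all i
    simp only [hu, hij, if_true, if_false] at this
    linarith
  intro l
  have := hu_all l
  simpa [hu, hi] using this

namespace Simplex

lemma IsChild.affineIndependent (hd : 0 < d) {T T' : Simplex d} (h : T'.IsChild T)
    (hT : AffineIndependent ℝ T.vertex) : AffineIndependent ℝ T'.vertex := by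
  have hk := T.k_pos hd
  have hne : T.kIdx ≠ 0 := by
    intro h0
    have := congrArg Fin.val h0
    simp only [kIdx, Fin.val_zero] at this
    omega
  rcases h with rfl | rfl
  · have := affineIndependent_update_midpoint hT hne
    rwa [midpoint_comm] at this
  · let σ : Fin (d + 1) → Fin (d + 1) := fun i =>
      if h : (i : ℕ) < T.k then ⟨(i : ℕ) + 1, by have hk := T.k_le; omega⟩
      else if (i : ℕ) = T.k then 0 else i
    have hσ : Function.Injective σ := by
      intro a b hab
      have hv := congrArg Fin.val hab
      simp only [σ] at hv
      ext
      split_ifs at hv <;> first | omega | (simp only [Fin.val_zero] at hv; omega)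
    have hcomp : T.child2.vertex = Function.update T.vertex 0 T.bsv ∘ σ := by
      funext i
      simp only [child2, σ, Function.comp_apply]
      split_ifs with h1 h2
      · rw [Function.update_of_ne]
        intro h0
        exact Nat.succ_ne_zero _ (congrArg Fin.val h0)
      · rw [Function.update_self]
      · rw [Function.update_of_ne]
        rintro rfl
        simp only [Fin.val_zero] at h1 h2
        omega
    rw [hcomp]
    exact (affineIndependent_update_midpoint hT hne.symm).comp_embedding ⟨σ, hσ⟩

end Simplex

namespace ColoredSetup

variable (S : ColoredSetup d)

lemma affineIndependent_of_memM (hd : 0 < d) {T : Simplex d} (hT : MemM S.T0 T) :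
    AffineIndependent ℝ T.vertex := by
  induction hT with
  | init h => exact S.indep _ h
  | child _ hc ih => exact hc.affineIndependent hd ih

/-- Edges spanned by the first `k + 1` vertices are bisected within the current cycle. -/
lemma vgen_midpoint_of_le_k {T : Simplex d} (hT : MemM S.T0 T) {i j : Fin (d + 1)}
    (hij : (i : ℕ) < j) (hj : (j : ℕ) ≤ T.k) :
    S.vgen (midpoint ℝ (T.vertex i) (T.vertex j)) = T.gen + T.k - ((j : ℤ) - i) + 1 := by
  obtain ⟨n, hn⟩ : ∃ n, n = T.k - ((j : ℕ) - i) := ⟨_, rfl⟩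
  induction n generalizing T i j with
  | zero =>
    have hi0 : i = 0 := Fin.ext (by simp only [Fin.val_zero]; omega)
    have hjk : j = T.kIdx := Fin.ext (by simp only [Simplex.kIdx]; omega)
    have := S.vgen_bsv T hT
    rw [Simplex.bsv, ← hi0, ← hjk] at this
    rw [this]
    omega
  | succ n ih =>
    rcases hj.lt_or_eq with hlt | heq
    · have hk : T.child1.k = T.k - 1 := Simplex.k_of_gen_succ rfl (by omega)
      have hg : T.child1.gen = T.gen + 1 := rfl
      have := ih (hT.child (.inl rfl)) hij (by omega) (by omega)
      rw [Simplex.child1_vertex (by omega), Simplex.child1_vertex (by omega)] at this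
      rw [this]
      omega
    · have hk : T.child2.k = T.k - 1 := Simplex.k_of_gen_succ rfl (by omega)
      have hg : T.child2.gen = T.gen + 1 := rfl
      have := ih (i := ⟨(i : ℕ) - 1, by omega⟩) (j := ⟨(j : ℕ) - 1, by omega⟩)
        (hT.child (.inr rfl)) (by simp only; omega) (by simp only; omega) (by simp only; omega)
      rw [Simplex.child2_vertex_pred (by omega) (by omega),
        Simplex.child2_vertex_pred (by omega) (by omega)] at this
      rw [this]
      simp only
      omega

/-- Edges with an endpoint beyond position `k` are bisected in the next cycle, at the beginning of
which each of the first `k + 1` vertices has moved to position `0` of some descendant. -/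
lemma vgen_midpoint_of_k_lt (hd : 0 < d) {T : Simplex d} (hT : MemM S.T0 T) {i j : Fin (d + 1)}
    (hij : (i : ℕ) < j) (hj : T.k < (j : ℕ)) :
    S.vgen (midpoint ℝ (T.vertex i) (T.vertex j)) =
      T.gen + T.k + d - ((j : ℤ) - if (i : ℕ) ≤ T.k then 0 else (i : ℤ)) + 1 := by
  obtain ⟨n, hn⟩ : ∃ n, n + 1 = T.k := ⟨T.k - 1, by have := T.k_pos hd; omega⟩
  have hjd : (j : ℕ) ≤ d := by omega
  induction n generalizing T i with
  | zero =>
    by_cases hi : (i : ℕ) = T.k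
    · have hk : T.child2.k = d := Simplex.k_of_gen_succ_of_k_eq_one hd rfl (by omega)
      have hg : T.child2.gen = T.gen + 1 := rfl
      have := S.vgen_midpoint_of_le_k (i := ⟨(i : ℕ) - 1, by omega⟩) (j := j)
        (hT.child (.inr rfl)) (by simp only; omega) (by omega)
      rw [Simplex.child2_vertex_pred (by omega) (by omega),
        Simplex.child2_vertex_of_gt hj] at this
      rw [this]
      simp only
      split_ifs <;> omega
    · have hk : T.child1.k = d := Simplex.k_of_gen_succ_of_k_eq_one hd rfl (by omega)
      have hg : T.child1.gen = T.gen + 1 := rfl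
      have := S.vgen_midpoint_of_le_k (i := i) (j := j) (hT.child (.inl rfl)) hij (by omega)
      rw [Simplex.child1_vertex hi, Simplex.child1_vertex (by omega)] at this
      rw [this]
      split_ifs <;> omega
  | succ n ih =>
    by_cases hi : (i : ℕ) = T.k
    · have hk : T.child2.k = T.k - 1 := Simplex.k_of_gen_succ rfl (by omega)
      have hg : T.child2.gen = T.gen + 1 := rfl
      have := ih (i := ⟨(i : ℕ) - 1, by omega⟩) (hT.child (.inr rfl)) (by simp only; omega)
        (by omega) (by omega)
      rw [Simplex.child2_vertex_pred (by omega) (by omega),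
        Simplex.child2_vertex_of_gt hj] at this
      rw [this]
      simp only
      split_ifs <;> omega
    · have hk : T.child1.k = T.k - 1 := Simplex.k_of_gen_succ rfl (by omega)
      have hg : T.child1.gen = T.gen + 1 := rfl
      have := ih (hT.child (.inl rfl)) hij (by omega) (by omega)
      rw [Simplex.child1_vertex hi, Simplex.child1_vertex (by omega)] at this
      rw [this]
      split_ifs <;> omega

/-- The generations of the bisection vertices of the edges at a fixed vertex lie in an interval of
length `d - 1`. -/
lemma vgen_midpoint_mem_Icc (hd : 0 < d) {T : Simplex d} (hT : MemM S.T0 T) {m n : Fin (d + 1)}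
    (hmn : m ≠ n) :
    S.vgen (midpoint ℝ (T.vertex m) (T.vertex n)) ∈
      Set.Icc ((T.gen : ℤ) + 1 + if (m : ℕ) ≤ T.k then 0 else (T.k : ℤ))
        (T.gen + d + if (m : ℕ) ≤ T.k then 0 else (T.k : ℤ)) := by
  have hk := T.k_pos hd
  have hkd := T.k_le
  have hm := m.isLt
  have hn := n.isLt
  rw [Set.mem_Icc]
  rcases lt_or_gt_of_ne (Fin.val_ne_of_ne hmn) with h | h
  · rcases le_or_gt (n : ℕ) T.k with hnk | hnk
    · rw [S.vgen_midpoint_of_le_k hT h hnk]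
      split_ifs <;> omega
    · rw [S.vgen_midpoint_of_k_lt hd hT h hnk]
      split_ifs <;> omega
  · rw [midpoint_comm]
    rcases le_or_gt (m : ℕ) T.k with hmk | hmk
    · rw [S.vgen_midpoint_of_le_k hT h hmk]
      split_ifs <;> omega
    · rw [S.vgen_midpoint_of_k_lt hd hT h hmk]
      split_ifs <;> omega

end ColoredSetup

/-- An edge of `T` containing the vertex at position `m` joins it to a vertex at another
position. -/
lemma Simplex.exists_eq_of_mem_E {T : Simplex d} (hinj : Function.Injective T.vertex)
    {m : Fin (d + 1)} {e : Sym2 (Pt d)} (he : e ∈ T.E) (hm : T.vertex m ∈ e) :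
    ∃ n, m ≠ n ∧ e = s(T.vertex m, T.vertex n) := by
  obtain ⟨i, j, hij, rfl⟩ := he
  rcases Sym2.mem_iff.1 hm with h | h
  · obtain rfl := hinj h
    exact ⟨j, hij, rfl⟩
  · obtain rfl := hinj h
    exact ⟨i, hij.symm, Sym2.eq_swap⟩

theorem gensharp_in_simplex (d : ℕ) (hd : 2 ≤ d) (S : ColoredSetup d)
    (T : Simplex d) (hT : MemM S.T0 T) (v : Pt d) (hv : v ∈ T.V)
    (e e' : Sym2 (Pt d)) (he : e ∈ T.E) (he' : e' ∈ T.E)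
    (hve : v ∈ e) (hve' : v ∈ e') :
    |S.genSharpE e - S.genSharpE e'| ≤ (d : ℤ) - 1 := by
  have hd0 : 0 < d := by omega
  have hinj := (S.affineIndependent_of_memM hd0 hT).injective
  obtain ⟨m, rfl⟩ := hv
  obtain ⟨n, hn, rfl⟩ := Simplex.exists_eq_of_mem_E hinj he hve
  obtain ⟨n', hn', rfl⟩ := Simplex.exists_eq_of_mem_E hinj he' hve'
  have h := S.vgen_midpoint_mem_Icc hd0 hT hn
  have h' := S.vgen_midpoint_mem_Icc hd0 hT hn'
  rw [Set.mem_Icc] at h h'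
  change |S.vgen (midpoint ℝ _ _) - S.vgen (midpoint ℝ _ _)| ≤ _
  rw [abs_le]
  constructor <;> linarith [h.1, h.2, h'.1, h'.2]

end BisecGrading
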